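/- arXiv:1102.2700 — 2 statements merged into one kernel-verified Lean document; each statement's English description precedes it below -/
import Mathlib

section
/- For the PUM code based on Gabidulin codes with dual memory m_H = 1 and rate R ≥ 1/2, the extended row rank distances satisfy, for every ℓ ≥ 2: every tuple (c_0, …, c_{ℓ−1}) ∈ (F^n)^ℓ with all c_j ≠ 0 satisfying H_0·c_0^T = 0, H_0·c_j^T + H_1·c_{j−1}^T = 0 for 1 ≤ j ≤ ℓ−1, and H_1·c_{ℓ−1}^T = 0, has sum rank weight Σ_{j=0}^{ℓ−1} rank_q(c_j) ≥ ⌈(ℓ+1)/2⌉·(n − k + 1); that is, d^r_ℓ ≥ ⌈(ℓ+1)/2⌉·(n − k + 1). -/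
open Matrix

/-- The rank norm of a vector `v ∈ F^n`. -/
noncomputable def rankq (Fq : Type*) {F : Type*} [Field Fq] [Field F] [Algebra Fq F]
    {n : ℕ} (v : Fin n → F) : ℕ :=
  Module.finrank Fq (Submodule.span Fq (Set.range v))

/-- The `r × n` Moore (Frobenius) matrix `V_r(h)` with `(i,j)` entry `h_j^(q^i)`. -/
noncomputable def moore (q r : ℕ) {F : Type*} [Field F] {n : ℕ} (h : Fin n → F) :
    Matrix (Fin r) (Fin n) F :=
  Matrix.of fun i j => h j ^ q ^ (i : ℕ)

/-- A `q`-linearized polynomial of `q`-degree less than `t` that vanishes at `t` elements which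
are linearly independent over the field of `q` elements is zero. -/
theorem linearized_coeff_eq_zero {Fq F : Type*} [Field Fq] [Fintype Fq] [Field F] [Algebra Fq F]
    {t : ℕ} {w : Fin t → F} (hw : LinearIndependent Fq w) {x : Fin t → F}
    (hx : ∀ a, ∑ i, x i * w a ^ Fintype.card Fq ^ (i : ℕ) = 0) : x = 0 := by
  classical
  have hq : 1 < Fintype.card Fq := Fintype.one_lt_card
  let L : F →ₗ[Fq] F :=
    ∑ i, LinearMap.mulLeft Fq (x i) ∘ₗ (FiniteField.frobeniusAlgHom Fq F ^ (i : ℕ)).toLinearMap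
  have hL (y : F) : L y = ∑ i, x i * y ^ Fintype.card Fq ^ (i : ℕ) := by
    simp [L, FiniteField.coe_frobeniusAlgHom, pow_iterate]
  let p : Polynomial F :=
    ∑ i, Polynomial.C (x i) * Polynomial.X ^ Fintype.card Fq ^ (i : ℕ)
  have hdeg : p.natDegree < Fintype.card (Fin t → Fq) := by
    have hpos : 0 < Fintype.card Fq ^ t := by positivity
    rw [Fintype.card_fun, Fintype.card_fin]
    refine lt_of_le_of_lt (Polynomial.natDegree_sum_le_of_forall_le (n := Fintype.card Fq ^ t - 1)
      _ _ fun i _ => ?_) (by omega)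
    have hi : Fintype.card Fq ^ (i : ℕ) < Fintype.card Fq ^ t := Nat.pow_lt_pow_right hq i.2
    exact (Polynomial.natDegree_C_mul_X_pow_le _ _).trans (by omega)
  have hp : p = 0 := by
    refine Polynomial.eq_zero_of_natDegree_lt_card_of_eval_eq_zero p
      (f := Fintype.linearCombination Fq w) (hw.fintypeLinearCombination_injective)
      (fun l => ?_) hdeg
    have heval : p.eval (Fintype.linearCombination Fq w l) =
        L (Fintype.linearCombination Fq w l) := by
      simp [p, hL, Polynomial.eval_finsetSum]
    rw [heval, Fintype.linearCombination_apply, map_sum]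
    exact Finset.sum_eq_zero fun a _ => by rw [map_smul, hL, hx, smul_zero]
  funext i
  have hcoeff : p.coeff (Fintype.card Fq ^ (i : ℕ)) = x i := by
    simp [p, Polynomial.coeff_C_mul, Polynomial.coeff_X_pow,
      Nat.pow_right_inj hq, Fin.val_inj]
  simp [← hcoeff, hp]

/-- The square Moore matrix of linearly independent elements has trivial kernel. -/
theorem eq_zero_of_moore_mulVec_eq_zero {Fq F : Type*} [Field Fq] [Fintype Fq] [Field F]
    [Algebra Fq F] {t : ℕ} {w : Fin t → F} (hw : LinearIndependent Fq w) {b : Fin t → F}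
    (hb : (moore (Fintype.card Fq) t w).mulVec b = 0) : b = 0 := by
  by_contra hne
  obtain ⟨x, hx, hx0⟩ := exists_vecMul_eq_zero_iff.2 (exists_mulVec_eq_zero_iff.1 ⟨b, hne, hb⟩)
  exact hx (linearized_coeff_eq_zero hw fun a => congrFun hx0 a)

/-- A nonzero vector in the kernel of `r` rows of Frobenius powers of linearly independent
elements has rank norm greater than `r`. -/
theorem lt_finrank_span_range_of_frobenius_sum_eq_zero {Fq F ι : Type*} [Field Fq] [Fintype Fq]
    [Field F] [Algebra Fq F] [Fintype ι] {g : ι → F} (hg : LinearIndependent Fq g) {v : ι → F}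
    (hv : v ≠ 0) {r : ℕ} (hr : ∀ i < r, ∑ j, g j ^ Fintype.card Fq ^ i * v j = 0) :
    r < Module.finrank Fq (Submodule.span Fq (Set.range v)) := by
  by_contra! hle
  have : FiniteDimensional Fq (Submodule.span Fq (Set.range v)) :=
    FiniteDimensional.span_of_finite Fq (Set.finite_range v)
  let B := Module.finBasis Fq (Submodule.span Fq (Set.range v))
  let u (j : ι) : Submodule.span Fq (Set.range v) :=
    ⟨v j, Submodule.subset_span (Set.mem_range_self j)⟩
  let w (a) : F := ∑ j, B.repr (u j) a • g j
  have hvB (j : ι) : v j = ∑ a, B.repr (u j) a • (B a : F) := by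
    have hsum := congrArg Subtype.val (B.sum_repr (u j))
    rw [Submodule.coe_sum] at hsum
    exact hsum.symm
  have hw : LinearIndependent Fq w := by
    rw [Fintype.linearIndependent_iff]
    intro l hl
    have hcoord : ∀ j, ∑ a, l a * B.repr (u j) a = 0 := by
      refine Fintype.linearIndependent_iff.1 hg _ ?_
      simp_rw [Finset.sum_smul, mul_smul]
      rw [Finset.sum_comm, ← hl]
      simp_rw [w, Finset.smul_sum]
    have hzero : B.constr Fq l = 0 := by
      refine LinearMap.ext_on_range (v := u) ?_ fun j => ?_
      · have hu : Set.range u = Subtype.val ⁻¹' Set.range v := by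
          ext y
          simp [u, Subtype.ext_iff]
        rw [hu]
        exact Submodule.span_span_coe_preimage (R := Fq) (s := Set.range v)
      · rw [Module.Basis.constr_apply_fintype]
        simpa [Module.Basis.equivFun_apply, mul_comm] using hcoord j
    intro a
    simpa using LinearMap.congr_fun hzero (B a)
  have hB : (fun a => (B a : F)) = 0 := by
    refine eq_zero_of_moore_mulVec_eq_zero hw (funext fun i => ?_)
    rw [Pi.zero_apply, ← hr i (i.2.trans_le hle)]
    have hwpow (a) : w a ^ Fintype.card Fq ^ (i : ℕ) =
        ∑ j, B.repr (u j) a • g j ^ Fintype.card Fq ^ (i : ℕ) := by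
      have hfrob (y : F) : (FiniteField.frobeniusAlgHom Fq F ^ (i : ℕ)) y =
          y ^ Fintype.card Fq ^ (i : ℕ) := by
        simp [FiniteField.coe_frobeniusAlgHom, pow_iterate]
      simp_rw [← hfrob, w, map_sum, map_smul]
    simp only [mulVec, dotProduct, moore, of_apply, hwpow, Finset.sum_mul]
    rw [Finset.sum_comm]
    refine Finset.sum_congr rfl fun j _ => ?_
    rw [hvB j, Finset.mul_sum]
    exact Finset.sum_congr rfl fun a _ => by rw [smul_mul_assoc, mul_smul_comm]
  refine hv (funext fun j => ?_)
  rw [hvB j]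
  exact Finset.sum_eq_zero fun a _ => by rw [show (B a : F) = 0 from congrFun hB a, smul_zero]

/-- The rank norm of a concatenation is at most the sum of the rank norms. -/
theorem finrank_span_range_sumElim_le {Fq F : Type*} [Field Fq] [Field F] [Algebra Fq F]
    {m n : ℕ} (v : Fin m → F) (w : Fin n → F) :
    Module.finrank Fq (Submodule.span Fq (Set.range (Sum.elim v w))) ≤
      rankq Fq v + rankq Fq w := by
  have : FiniteDimensional Fq (Submodule.span Fq (Set.range v)) :=
    FiniteDimensional.span_of_finite Fq (Set.finite_range v)
  have : FiniteDimensional Fq (Submodule.span Fq (Set.range w)) :=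
    FiniteDimensional.span_of_finite Fq (Set.finite_range w)
  rw [Set.Sum.elim_range, Submodule.span_union]
  exact Submodule.finrank_add_le_finrank_add_finrank _ _

/-- If consecutive terms of a sequence sum to at least `d` and the first term is at least `d`,
then the sum of the first `m` terms is at least `⌈m / 2⌉ * d`. -/
theorem div_two_mul_le_sum_range_of_le_add {f : ℕ → ℕ} {d : ℕ} (hf : d ≤ f 0) :
    ∀ m, (∀ j, j + 1 < m → d ≤ f j + f (j + 1)) → (m + 1) / 2 * d ≤ ∑ j ∈ Finset.range m, f j
  | 0, _ => by simp
  | 1, _ => by simpa using hf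
  | m + 2, hpair => by
    have ih := div_two_mul_le_sum_range_of_le_add hf m fun j hj => hpair j (by omega)
    have hlast := hpair m (by omega)
    rw [Finset.sum_range_succ, Finset.sum_range_succ,
      show (m + 2 + 1) / 2 = (m + 1) / 2 + 1 by omega, Nat.add_mul, one_mul]
    omega

/-- Lower bound on the extended row rank distances of the PUM code based on Gabidulin
codes with `m_H = 1` and rate `R ≥ 1/2`: for every `ℓ ≥ 2`,
`d^r_ℓ ≥ ⌈(ℓ+1)/2⌉ · (n - k + 1)`. -/
theorem pum_gabidulin_extended_row_rank_distance_lower_bound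
    (Fq F : Type*) [Field Fq] [Fintype Fq] [Field F] [Algebra Fq F]
    [FiniteDimensional Fq F] (n k : ℕ) (hk : 1 ≤ k) (hkn : k < n) (hR : n ≤ 2 * k)
    (h : Fin n → F)
    (hli : LinearIndependent Fq
      (Sum.elim h (fun j => h j ^ Fintype.card Fq ^ (n - k)) : Fin n ⊕ Fin n → F))
    (ℓ : ℕ) (hℓ : 2 ≤ ℓ) (c : ℕ → Fin n → F)
    (hcz : ∀ j, j < ℓ → c j ≠ 0)
    (h0 : (moore (Fintype.card Fq) (n - k) h).mulVec (c 0) = 0)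
    (hmid : ∀ j, 1 ≤ j → j < ℓ →
      (moore (Fintype.card Fq) (n - k) h).mulVec (c j) +
        (moore (Fintype.card Fq) (n - k)
          (fun j' => h j' ^ Fintype.card Fq ^ (n - k))).mulVec (c (j - 1)) = 0)
    (hend : (moore (Fintype.card Fq) (n - k)
        (fun j' => h j' ^ Fintype.card Fq ^ (n - k))).mulVec (c (ℓ - 1)) = 0) :
    (ℓ + 2) / 2 * (n - k + 1) ≤ ∑ j ∈ Finset.range ℓ, rankq Fq (c j) := by
  have hfirst : n - k + 1 ≤ rankq Fq (c 0) :=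
    lt_finrank_span_range_of_frobenius_sum_eq_zero (hli.comp _ Sum.inl_injective)
      (hcz 0 (by omega)) fun i hi => congrFun h0 ⟨i, hi⟩
  have hlast : n - k + 1 ≤ rankq Fq (c (ℓ - 1)) :=
    lt_finrank_span_range_of_frobenius_sum_eq_zero (hli.comp _ Sum.inr_injective)
      (hcz (ℓ - 1) (by omega)) fun i hi => congrFun hend ⟨i, hi⟩
  have hpair (j : ℕ) (hj : j + 1 < ℓ) : n - k + 1 ≤ rankq Fq (c j) + rankq Fq (c (j + 1)) := by
    have hlt := lt_finrank_span_range_of_frobenius_sum_eq_zero hli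
      (v := Sum.elim (c (j + 1)) (c j)) (r := n - k)
      (fun hzero => hcz j (by omega) (funext fun i => congrFun hzero (Sum.inr i)))
      fun i hi => by
        rw [Fintype.sum_sum_type]
        exact congrFun (hmid (j + 1) (by omega) hj) ⟨i, hi⟩
    have hle := finrank_span_range_sumElim_le (Fq := Fq) (c (j + 1)) (c j)
    omega
  obtain ⟨m, rfl⟩ : ∃ m, ℓ = m + 1 := ⟨ℓ - 1, by omega⟩
  have hsum := div_two_mul_le_sum_range_of_le_add hfirst m fun j hj => hpair j (by omega)
  rw [Finset.sum_range_succ, show (m + 1 + 2) / 2 = (m + 1) / 2 + 1 by omega, Nat.add_mul, one_mul]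
  exact Nat.add_le_add hsum hlast
end

section
/- For the PUM code based on Gabidulin codes with dual memory m_H = 1 and rate R > 1/2 (i.e., 2k > n), the free rank distance achieves the upper bound for PUM codes: every nonzero finitely supported codeword sequence c = (c_0, c_1, …) ∈ (F^n)^ℕ satisfying H_0·c_j^T + H_1·c_{j−1}^T = 0 for all j ≥ 0 (with c_{−1} = 0) has sum rank weight Σ_j rank_q(c_j) ≥ 2(n − k) + 1, and this bound is attained; hence d_free = 2(n − k) + 1 = n − k + ν + 1 where ν = n − k. -/
open Matrix

/-- The `l`-th power of the `q`-Frobenius endomorphism, evaluated. -/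
theorem frobeniusAlgHom_pow_apply {Fq F : Type*} [Field Fq] [Fintype Fq] [Field F] [Algebra Fq F]
    (l : ℕ) (x : F) : (FiniteField.frobeniusAlgHom Fq F ^ l) x = x ^ Fintype.card Fq ^ l := by
  rw [AlgHom.coe_pow, FiniteField.coe_frobeniusAlgHom, pow_iterate]

open Polynomial in
/-- A linearized polynomial of `q`-degree less than `m` that vanishes on `m` elements which are
linearly independent over the field with `q` elements is zero. -/
theorem linearized_eq_zero {Fq F : Type*} [Field Fq] [Fintype Fq] [Field F] [Algebra Fq F]
    {m : ℕ} {g : Fin m → F} (hg : LinearIndependent Fq g) {u : Fin m → F}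
    (hu : ∀ i, ∑ l : Fin m, u l * g i ^ Fintype.card Fq ^ (l : ℕ) = 0) : u = 0 := by
  classical
  have hq : 1 < Fintype.card Fq := Fintype.one_lt_card
  let L : F →ₗ[Fq] F := ∑ l : Fin m,
    LinearMap.mulLeft Fq (u l) ∘ₗ ((FiniteField.frobeniusAlgHom Fq F) ^ (l : ℕ)).toLinearMap
  have hL : ∀ x, L x = ∑ l : Fin m, u l * x ^ Fintype.card Fq ^ (l : ℕ) := fun x => by
    simp only [L, LinearMap.sum_apply, LinearMap.comp_apply, LinearMap.mulLeft_apply,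
      AlgHom.toLinearMap_apply, frobeniusAlgHom_pow_apply]
  let P : F[X] := ∑ l : Fin m, C (u l) * X ^ Fintype.card Fq ^ (l : ℕ)
  have hP : P = 0 := by
    let f : (Fin m → Fq) → F := Fintype.linearCombination Fq g
    refine eq_zero_of_natDegree_lt_card_of_eval_eq_zero P
      (f := f) ?_ (fun a => ?_) ?_
    · exact hg.fintypeLinearCombination_injective
    · have : L (f a) = 0 := by
        simp [f, Fintype.linearCombination_apply, hL (g _), hu]
      rw [hL] at this
      simpa [P, eval_finsetSum] using this
    · rw [Fintype.card_fun, Fintype.card_fin]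
      rcases m with _ | m
      · simp [P]
      · refine lt_of_le_of_lt (natDegree_sum_le_of_forall_le _ _ fun l _ => ?_)
          (Nat.pow_lt_pow_right hq (Nat.lt_succ_self m))
        exact (natDegree_C_mul_X_pow_le _ _).trans
          (Nat.pow_le_pow_right (by omega) (by omega))
  funext l
  have := congrArg (fun p => p.coeff (Fintype.card Fq ^ (l : ℕ))) hP
  simpa [P, finsetSum_coeff, coeff_C_mul, coeff_X_pow, Nat.pow_right_inj hq, Fin.val_inj] using this

/-- A square Moore matrix of linearly independent elements has trivial kernel. -/
theorem moore_mulVec_injective {Fq F : Type*} [Field Fq] [Fintype Fq] [Field F] [Algebra Fq F]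
    {m : ℕ} {g : Fin m → F} (hg : LinearIndependent Fq g) {b : Fin m → F}
    (hb : (moore (Fintype.card Fq) m g).mulVec b = 0) : b = 0 := by
  by_contra hne
  obtain ⟨u, hu, hu0⟩ :=
    Matrix.exists_vecMul_eq_zero_iff.mpr (Matrix.exists_mulVec_eq_zero_iff.mp ⟨b, hne, hb⟩)
  refine hu (linearized_eq_zero hg fun i => ?_)
  simpa [moore, Matrix.vecMul, dotProduct] using congrFun hu0 i

/-- The minimum rank distance of a Gabidulin code: a nonzero vector in the kernel of `V_m(h)` has
rank norm larger than `m`. -/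
theorem lt_rankq_of_moore_mulVec_eq_zero {Fq F : Type*} [Field Fq] [Fintype Fq] [Field F]
    [Algebra Fq F] {n m : ℕ} {h : Fin n → F} (hh : LinearIndependent Fq h) {c : Fin n → F}
    (hc : c ≠ 0) (hm : (moore (Fintype.card Fq) m h).mulVec c = 0) : m < rankq Fq c := by
  by_contra! hle
  let S := Submodule.span Fq (Set.range c)
  have : FiniteDimensional Fq S := FiniteDimensional.span_of_finite Fq (Set.finite_range c)
  let b : Module.Basis (Fin (rankq Fq c)) Fq S := Module.finBasis Fq S
  have hmem : ∀ j, c j ∈ S := fun j => Submodule.subset_span ⟨j, rfl⟩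
  let A : Fin (rankq Fq c) → Fin n → Fq := fun i j => b.repr ⟨c j, hmem j⟩ i
  have hA : ∀ j, ∑ i, A i j • (b i : F) = c j := fun j => by
    have hj := congrArg S.subtype (b.sum_repr ⟨c j, hmem j⟩)
    rwa [map_sum] at hj
  let g : Fin (rankq Fq c) → F := fun i => ∑ j, A i j • h j
  have hg : LinearIndependent Fq g := by
    rw [Fintype.linearIndependent_iff] at hh ⊢
    intro u hu
    have hcol : ∀ j, ∑ i, u i * A i j = 0 := by
      apply hh
      simp only [g, Finset.smul_sum, smul_smul] at hu
      rw [Finset.sum_comm] at hu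
      simpa [Finset.sum_smul] using hu
    let f : S →ₗ[Fq] Fq := ∑ i, u i • b.coord i
    have hf : f = 0 := by
      have hspan : ∀ x (hx : x ∈ S), f ⟨x, hx⟩ = 0 := by
        intro x hx
        induction hx using Submodule.span_induction with
        | mem x hx =>
          obtain ⟨j, rfl⟩ := hx
          simpa [f, A] using hcol j
        | zero => exact map_zero f
        | add x y hx hy ihx ihy =>
          rw [← add_zero (0 : Fq)]; nth_rewrite 1 [← ihx]; rw [← ihy, ← map_add]; rfl
        | smul a x hx ih =>
          rw [← smul_zero a, ← ih, ← map_smul]; rfl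
      exact LinearMap.ext fun x => hspan x x.2
    intro i
    simpa [f, Finsupp.single_apply] using LinearMap.congr_fun hf (b i)
  have hb : (fun i => (b i : F)) = 0 := by
    refine moore_mulVec_injective hg (funext fun l => ?_)
    have hl := congrFun hm ⟨l, l.2.trans_le hle⟩
    simp only [moore, mulVec, dotProduct, Matrix.of_apply, Pi.zero_apply] at hl ⊢
    rw [← hl]
    have hpow : ∀ x : F, x ^ Fintype.card Fq ^ (l : ℕ) =
        ((FiniteField.frobeniusAlgHom Fq F) ^ (l : ℕ)) x := fun x =>
      (frobeniusAlgHom_pow_apply _ x).symm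
    simp only [hpow, g, map_sum, map_smul, ← hA, Finset.sum_mul, Finset.mul_sum]
    rw [Finset.sum_comm]
    simp
  apply hc
  funext j
  rw [← hA j]
  exact Finset.sum_eq_zero fun i _ => by simp [show (b i : F) = 0 from congrFun hb i]

/-- Stacking `V_r(h)` on top of `V_r(h^(q^r))` gives `V_{2r}(h)`. -/
theorem moore_two_mul_mulVec_eq_zero_iff {F : Type*} [Field F] {n : ℕ} (q r : ℕ)
    (h c : Fin n → F) :
    (moore q (2 * r) h).mulVec c = 0 ↔
      (moore q r h).mulVec c = 0 ∧ (moore q r (fun j => h j ^ q ^ r)).mulVec c = 0 := by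
  simp only [funext_iff, moore, mulVec, dotProduct, Matrix.of_apply, Pi.zero_apply, ← pow_mul,
    ← pow_add]
  refine ⟨fun H => ⟨fun l => H ⟨l, by omega⟩, fun l => H ⟨r + l, by omega⟩⟩, fun H l => ?_⟩
  by_cases hl : (l : ℕ) < r
  · exact H.1 ⟨l, hl⟩
  · have := H.2 ⟨l - r, by omega⟩
    rwa [show r + (l - r : ℕ) = l by omega] at this

theorem rankq_zero (Fq : Type*) {F : Type*} [Field Fq] [Field F] [Algebra Fq F] {n : ℕ} :
    rankq Fq (0 : Fin n → F) = 0 := by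
  have : Submodule.span Fq (Set.range (0 : Fin n → F)) = ⊥ := by
    rw [Submodule.span_eq_bot]
    rintro _ ⟨j, rfl⟩
    rfl
  rw [rankq, this, finrank_bot]

/-- A matrix with fewer than `m ≤ n` rows annihilates a nonzero vector of rank norm at most `m`. -/
theorem exists_mulVec_eq_zero_rankq_le (Fq : Type*) {F : Type*} [Field Fq] [Field F]
    [Algebra Fq F] {l m n : ℕ} (hlm : l < m) (hmn : m ≤ n) (M : Matrix (Fin l) (Fin n) F) :
    ∃ c : Fin n → F, c ≠ 0 ∧ M.mulVec c = 0 ∧ rankq Fq c ≤ m := by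
  classical
  let e := Fin.castLEEmb hmn
  obtain ⟨v, hv, hv0⟩ := Submodule.exists_mem_ne_zero_of_ne_bot
    ((M.submatrix id e).mulVecLin.ker_ne_bot_of_finrank_lt (by simpa using hlm))
  let c : Fin n → F := Function.extend e v 0
  have hce : ∀ i, c (e i) = v i := fun i => e.injective.extend_apply _ _ i
  have hcn : ∀ j, j ∉ Set.range e → c j = 0 := fun j hj => Function.extend_apply' _ _ j hj
  refine ⟨c, fun hc => hv0 (funext fun i => by rw [← hce, hc]; rfl), funext fun i => ?_, ?_⟩
  · have hi := congrFun (LinearMap.mem_ker.mp hv) i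
    simp only [mulVecLin_apply, mulVec, dotProduct, submatrix_apply, id] at hi ⊢
    rw [← hi, ← Fintype.sum_of_injective e e.injective _ _ (fun j hj => by rw [hcn j hj, mul_zero])
      (fun i => by rw [hce])]
  · have hspan : Submodule.span Fq (Set.range c) ≤ Submodule.span Fq (Set.range v) := by
      rw [Submodule.span_le]
      rintro _ ⟨j, rfl⟩
      by_cases hj : j ∈ Set.range e
      · obtain ⟨i, rfl⟩ := hj
        exact Submodule.subset_span ⟨i, (hce i).symm⟩
      · rw [hcn j hj]
        exact zero_mem _
    have := FiniteDimensional.span_of_finite Fq (Set.finite_range v)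
    exact (Submodule.finrank_mono hspan).trans
      ((finrank_range_le_card v).trans_eq (Fintype.card_fin m))

/-- The PUM code based on Gabidulin codes with `m_H = 1` and rate `R > 1/2` achieves
the upper bound on the free rank distance: `d_free = 2(n - k) + 1 = n - k + ν + 1`
with `ν = n - k`. -/
theorem pum_gabidulin_free_rank_distance
    (Fq F : Type*) [Field Fq] [Fintype Fq] [Field F] [Algebra Fq F]
    [FiniteDimensional Fq F] (n k : ℕ) (hk : 1 ≤ k) (hkn : k < n) (hR : n < 2 * k)
    (h : Fin n → F)
    (hli : LinearIndependent Fq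
      (Sum.elim h (fun j => h j ^ Fintype.card Fq ^ (n - k)) : Fin n ⊕ Fin n → F)) :
    sInf {w : ℕ | ∃ c : ℕ → Fin n → F, (∃ N, ∀ j, N ≤ j → c j = 0) ∧ c ≠ 0 ∧
        (∀ j : ℕ, (moore (Fintype.card Fq) (n - k) h).mulVec (c j) +
          (if j = 0 then 0 else (moore (Fintype.card Fq) (n - k)
            (fun j' => h j' ^ Fintype.card Fq ^ (n - k))).mulVec (c (j - 1))) = 0) ∧
        w = ∑ᶠ j, rankq Fq (c j)} = 2 * (n - k) + 1 := by
  have hh : LinearIndependent Fq h := hli.comp Sum.inl Sum.inl_injective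
  have hh' : LinearIndependent Fq (fun j => h j ^ Fintype.card Fq ^ (n - k)) :=
    hli.comp Sum.inr Sum.inr_injective
  refine IsLeast.csInf_eq ⟨?_, ?_⟩
  · obtain ⟨c, hc, hc0, hcr⟩ := exists_mulVec_eq_zero_rankq_le Fq
      (l := 2 * (n - k)) (m := 2 * (n - k) + 1) (by omega) (by omega)
      (moore (Fintype.card Fq) (2 * (n - k)) h)
    obtain ⟨h0, h1⟩ := (moore_two_mul_mulVec_eq_zero_iff _ _ _ _).mp hc0
    refine ⟨Pi.single 0 c, ⟨1, fun j hj => Pi.single_eq_of_ne (by omega : j ≠ 0) _⟩, by simpa using hc,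
      fun j => ?_, ?_⟩
    · rcases j with _ | _ | j
      · simpa using h0
      · simpa using h1
      · simp
    · rw [finsum_eq_single _ 0 fun j hj => by rw [Pi.single_eq_of_ne hj, rankq_zero],
        Pi.single_eq_same]
      exact le_antisymm (lt_rankq_of_moore_mulVec_eq_zero hh hc hc0) hcr
  · rintro w ⟨c, ⟨N, hN⟩, hc, hcode, rfl⟩
    classical
    have hex : ∃ j, c j ≠ 0 := Function.ne_iff.mp hc
    let a := Nat.find hex
    have ha : c a ≠ 0 := Nat.find_spec hex
    have ha0 : ∀ j < a, c j = 0 := fun j hj => not_not.mp (Nat.find_min hex hj)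
    have hbound : ∀ j, c j ≠ 0 → j ≤ N := fun j hj => by
      by_contra hjN
      exact hj (hN j (by omega))
    let b := Nat.findGreatest (fun j => c j ≠ 0) N
    have hb : c b ≠ 0 := Nat.findGreatest_spec (P := fun j => c j ≠ 0) (hbound a ha) ha
    have hb0 : c (b + 1) = 0 := by
      by_contra hne
      exact absurd (Nat.le_findGreatest (hbound _ hne) hne) (Nat.not_succ_le_self b)
    have hfirst : (moore (Fintype.card Fq) (n - k) h).mulVec (c a) = 0 := by
      have := hcode a
      split_ifs at this with h0
      · simpa using this
      · rwa [ha0 (a - 1) (by omega), mulVec_zero, add_zero] at this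
    have hlast : (moore (Fintype.card Fq) (n - k)
        (fun j => h j ^ Fintype.card Fq ^ (n - k))).mulVec (c b) = 0 := by
      simpa [hb0] using hcode (b + 1)
    rw [finsum_eq_sum_of_support_subset (s := Finset.range (N + 1)) _ fun j hj => by
      have hne : c j ≠ 0 := fun h0 => hj (by simp only [h0, rankq_zero])
      simpa [Nat.lt_succ_iff] using hbound j hne]
    by_cases hab : a = b
    · have h2 := (moore_two_mul_mulVec_eq_zero_iff _ _ _ _).mpr ⟨hfirst, hab ▸ hlast⟩
      exact (Nat.succ_le_of_lt (lt_rankq_of_moore_mulVec_eq_zero hh ha h2)).trans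
        (Finset.single_le_sum (f := fun j => rankq Fq (c j)) (fun _ _ => Nat.zero_le _)
          (Finset.mem_range.mpr (Nat.lt_succ_of_le (hbound a ha))))
    · have hsum : ∑ j ∈ {a, b}, rankq Fq (c j) ≤ ∑ j ∈ Finset.range (N + 1), rankq Fq (c j) := by
        refine Finset.sum_le_sum_of_subset fun j hj => ?_
        rw [Finset.mem_insert, Finset.mem_singleton] at hj
        refine Finset.mem_range.mpr (Nat.lt_succ_of_le (hbound j ?_))
        rcases hj with rfl | rfl
        exacts [ha, hb]
      rw [Finset.sum_pair hab] at hsum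
      have h1 := lt_rankq_of_moore_mulVec_eq_zero hh ha hfirst
      have h2 := lt_rankq_of_moore_mulVec_eq_zero hh' hb hlast
      omega
end
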